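/- In a cubic Jordan algebra J(N,c), an element x is invertible if and only if N(x) ≠ 0, and in that case x^{-1} = N(x)^{-1} x^#. -/

import Mathlib

/-- A cubic norm structure `(N, #, c)` on a finite-dimensional `k`-vector space `J`:
a base point `c` with `N c = 1`, a nondegenerate trace bilinear form `T`,
and a quadratic adjoint `#` satisfying the directional-derivative expansion
`N (x + t•y) = N x + t·T(x^#,y) + t²·T(x,y^#) + t³·N y`, the adjoint identity
`x^{##} = N(x)·x`, `c^# = c`, and `c × x = T(x)·c − x`. -/
structure CubicNorm (k J : Type*) [Field k] [AddCommGroup J] [Module k J] where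
  c : J
  N : J → k
  T : J →ₗ[k] J →ₗ[k] k
  sharp : J → J
  base : N c = 1
  expand : ∀ (t : k) (x y : J),
    N (x + t • y) = N x + t * T (sharp x) y + t ^ 2 * T x (sharp y) + t ^ 3 * N y
  nondeg : ∀ x, (∀ y, T x y = 0) → x = 0
  sharp_smul : ∀ (t : k) (x : J), sharp (t • x) = t ^ 2 • sharp x
  adjoint : ∀ x, sharp (sharp x) = N x • x
  sharp_c : sharp c = c
  cross_c : ∀ x, sharp (c + x) - sharp c - sharp x = T x c • c - x

namespace CubicNorm

variable {k J : Type*} [Field k] [AddCommGroup J] [Module k J]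

/-- The Freudenthal cross product `x × y = (x+y)^# − x^# − y^#`. -/
def cross (S : CubicNorm k J) (x y : J) : J :=
  S.sharp (x + y) - S.sharp x - S.sharp y

/-- The `U`-operator `U_a(y) = T(a,y)·a − a^# × y`. -/
def U (S : CubicNorm k J) (a y : J) : J :=
  S.T a y • a - S.cross (S.sharp a) y

end CubicNorm

namespace CubicNorm

section General

variable {k J : Type*} [Field k] [AddCommGroup J] [Module k J] (S : CubicNorm k J)

theorem ext_T {x y : J} (h : ∀ z, S.T x z = S.T y z) : x = y :=
  sub_eq_zero.1 (S.nondeg _ fun z => by simp [h z])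

theorem sharp_zero : S.sharp 0 = 0 := by
  simpa using S.sharp_smul 0 0

theorem N_zero : S.N 0 = 0 := by
  have h := S.expand 1 0 0
  simp only [smul_zero, add_zero, map_zero, sharp_zero, mul_zero, one_pow, one_mul] at h
  simpa using h

theorem c_ne_zero : S.c ≠ 0 := fun h => by
  have := S.base
  rw [h, S.N_zero] at this
  exact zero_ne_one this

theorem N_add (x y : J) :
    S.N (x + y) = S.N x + S.T (S.sharp x) y + S.T x (S.sharp y) + S.N y := by
  simpa using S.expand 1 x y

theorem sharp_add (x y : J) :
    S.sharp (x + y) = S.sharp x + S.sharp y + S.cross x y := by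
  unfold cross; abel

theorem cross_comm (x y : J) : S.cross x y = S.cross y x := by
  unfold cross; rw [add_comm x y]; abel

theorem T_cross (x y z : J) : S.T (S.cross x y) z = S.T x (S.cross y z) := by
  have h1 := S.N_add (x + y) z
  have h2 := S.N_add x (y + z)
  rw [S.N_add x y, S.sharp_add x y] at h1
  rw [S.N_add y z, S.sharp_add y z, ← add_assoc] at h2
  simp only [map_add, LinearMap.add_apply] at h1 h2
  linear_combination h2 - h1

theorem cross_add_left (x y z : J) : S.cross (x + y) z = S.cross x z + S.cross y z :=
  S.ext_T fun w => by simp [T_cross]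

theorem cross_smul_left (t : k) (x z : J) : S.cross (t • x) z = t • S.cross x z :=
  S.ext_T fun w => by simp [T_cross]

theorem cross_add_right (x y z : J) : S.cross x (y + z) = S.cross x y + S.cross x z := by
  simp only [S.cross_comm x, cross_add_left]

theorem cross_smul_right (t : k) (x z : J) : S.cross x (t • z) = t • S.cross x z := by
  simp only [S.cross_comm x, cross_smul_left]

theorem cross_self (x : J) : S.cross x x = (2 : k) • S.sharp x := by
  unfold cross
  rw [← two_smul k x, S.sharp_smul]
  module

theorem cross_base (x : J) : S.cross S.c x = S.T x S.c • S.c - x := S.cross_c x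

theorem T_symm (x y : J) : S.T x y = S.T y x := by
  have h : ∀ x y : J, S.T (S.sharp x) y + S.T x (S.sharp y)
      = S.T (S.sharp y) x + S.T y (S.sharp x) := fun x y => by
    have h1 := S.N_add x y
    rw [add_comm x y, S.N_add y x] at h1
    linear_combination -h1
  have h' : ∀ x y z : J, S.T (S.cross y z) x = S.T x (S.cross y z) := fun x y z => by
    have h1 := h x (y + z)
    rw [sharp_add] at h1
    simp only [map_add, LinearMap.add_apply] at h1
    linear_combination h x y + h x z - h1
  have key : ∀ x y : J, S.T y S.c * S.T S.c x - S.T y x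
      = S.T y S.c * S.T x S.c - S.T x y := fun x y => by
    simpa [cross_base] using h' x S.c y
  have hc : ∀ y, S.T y S.c = S.T S.c y := fun y => by
    linear_combination -key S.c y
  linear_combination key x y + S.T y S.c * hc x

theorem T_base_base : S.T S.c S.c = 3 := by
  have h := S.cross_self S.c
  rw [cross_base, sharp_c, sub_eq_iff_eq_add] at h
  have : (S.T S.c S.c - 3) • S.c = 0 := by rw [sub_smul, h]; module
  rcases smul_eq_zero.1 this with h | h
  · linear_combination h
  · exact absurd h S.c_ne_zero

/-- The trace of a cross product. -/
theorem T_cross_base (x y : J) :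
    S.T (S.cross x y) S.c = S.T x S.c * S.T y S.c - S.T x y := by
  rw [T_cross, cross_comm, cross_base]
  simp only [map_sub, map_smul, smul_eq_mul]
  ring

/-- The degree three identity satisfied by every element, in terms of `x^# × x`. -/
theorem cross_sharp_self (x : J) : S.cross (S.sharp x) x =
    (S.T x S.c * S.T (S.sharp x) S.c - S.N x) • S.c - S.T (S.sharp x) S.c • x
      - S.T x S.c • S.sharp x := by
  have h := S.adjoint (S.c + x)
  have e : S.sharp (S.c + x) = (1 + S.T x S.c) • S.c + (S.sharp x + (-1 : k) • x) := by
    rw [sharp_add, sharp_c, cross_base]; module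
  rw [e] at h
  simp only [sharp_add, cross_smul_left, cross_smul_right, cross_base, sharp_smul, sharp_c,
    adjoint, N_add, base, map_add, map_smul, LinearMap.add_apply, LinearMap.smul_apply,
    smul_eq_mul, S.T_symm S.c] at h
  linear_combination (norm := module) -h

theorem T_sharp_self (x : J) : S.T (S.sharp x) x = 3 * S.N x := by
  have h := congrArg (fun z => S.T z S.c) (S.cross_sharp_self x)
  simp only [T_cross_base, map_sub, map_smul, LinearMap.sub_apply, LinearMap.smul_apply,
    smul_eq_mul, T_base_base] at h
  linear_combination -h

theorem U_sharp (x : J) : S.U x (S.sharp x) = S.N x • x := by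
  rw [U, S.T_symm, T_sharp_self, cross_self, adjoint]
  module

theorem U_smul (x : J) (t : k) (y : J) : S.U x (t • y) = t • S.U x y := by
  simp only [U, cross_smul_right, map_smul, smul_eq_mul]
  module

theorem U_add (x y z : J) : S.U x (y + z) = S.U x y + S.U x z := by
  simp only [U, cross_add_right, map_add]
  module

theorem N_ne_zero_of_U_bijective (x : J) (h : Function.Bijective (S.U x)) : S.N x ≠ 0 := by
  intro hN
  have h0 : S.sharp x = 0 := h.1 (by
    rw [U_sharp, hN, zero_smul]
    simpa using (S.U_smul x 0 0).symm)
  obtain ⟨y, hy⟩ := h.2 S.c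
  have hz : S.cross 0 y = 0 := by simpa using S.cross_smul_left 0 0 y
  rw [U, h0, hz, sub_zero] at hy
  have h1 := S.sharp_c
  rw [← hy, S.sharp_smul, h0, smul_zero, hy] at h1
  exact S.c_ne_zero h1.symm

end General

section CharTwo

variable {k J : Type*} [Field k] [AddCommGroup J] [Module k J] (S : CubicNorm k J)

/-- The Jordan square `x² = x^# + T(x) x + T(x^#) c`, with signs dropped (characteristic two). -/
def sq (x : J) : J :=
  S.sharp x + S.T x S.c • x + S.T (S.sharp x) S.c • S.c

/-- The polarisation of the Jordan square in characteristic two. -/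
def br (x y : J) : J :=
  S.cross x y + S.T x S.c • y + S.T y S.c • x + (S.T x S.c * S.T y S.c + S.T x y) • S.c

theorem br_comm (x y : J) : S.br x y = S.br y x := by
  rw [br, br, cross_comm, S.T_symm x y]
  module

theorem br_add_right (x y z : J) : S.br x (y + z) = S.br x y + S.br x z := by
  simp only [br, cross_add_right, map_add, LinearMap.add_apply]
  module

theorem br_smul_right (x y : J) (t : k) : S.br x (t • y) = t • S.br x y := by
  simp only [br, cross_smul_right, map_smul, LinearMap.smul_apply, smul_eq_mul]
  module

theorem br_add_left (x y z : J) : S.br (x + y) z = S.br x z + S.br y z := by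
  simp only [S.br_comm _ z, br_add_right]

theorem br_smul_left (x y : J) (t : k) : S.br (t • x) y = t • S.br x y := by
  simp only [S.br_comm _ y, br_smul_right]

theorem T_br (x y z : J) : S.T (S.br x y) z = S.T y (S.br x z) := by
  simp only [br, S.cross_comm x y, T_cross, map_add, map_smul, LinearMap.add_apply,
    LinearMap.smul_apply, smul_eq_mul, S.T_symm S.c, S.T_symm y x]
  ring

theorem trace_sharp_add (x y : J) : S.T (S.sharp (x + y)) S.c =
    S.T (S.sharp x) S.c + S.T (S.sharp y) S.c + (S.T x S.c * S.T y S.c - S.T x y) := by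
  rw [sharp_add, map_add, map_add, LinearMap.add_apply, LinearMap.add_apply, T_cross_base]

variable [CharP k 2]

theorem add_eq_zero_iff_of_charTwo (k : Type*) {J : Type*} [Field k] [CharP k 2]
    [AddCommGroup J] [Module k J] {x y : J} : x + y = 0 ↔ x = y := by
  have h : ∀ z : J, z + z = 0 := fun z => by
    rw [← two_smul k z, CharTwo.two_eq_zero, zero_smul]
  constructor
  · intro e
    rw [← add_right_cancel_iff (a := y), e, h]
  · rintro rfl
    exact h x

theorem sq_add (x y : J) : S.sq (x + y) = S.sq x + S.sq y + S.br x y := by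
  rw [sq, trace_sharp_add, sharp_add, CharTwo.sub_eq_add, sq, sq, br, map_add,
    LinearMap.add_apply]
  module

theorem T_self (x : J) : S.T x x = S.T x S.c * S.T x S.c := by
  have e := S.T_cross_base x x
  rw [cross_self] at e
  simp only [map_smul, LinearMap.smul_apply, smul_eq_mul] at e
  grind

theorem trace_br (x y : J) : S.T (S.br x y) S.c = 0 := by
  simp only [br, map_add, map_smul, LinearMap.add_apply, LinearMap.smul_apply, smul_eq_mul,
    T_cross_base, T_base_base]
  grind

theorem br_sq_self (x : J) : S.br (S.sq x) x = 0 := by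
  refine S.ext_T fun z => ?_
  simp only [br, sq, cross_add_left, cross_smul_left, cross_sharp_self, cross_self, cross_base,
    map_add, map_sub, map_smul, LinearMap.add_apply, LinearMap.sub_apply, LinearMap.smul_apply,
    smul_eq_mul, T_base_base, T_sharp_self, S.T_symm S.c x, map_zero, LinearMap.zero_apply]
  have e := S.T_self x
  grind

theorem T_sq_br (x y : J) : S.T (S.sq x) (S.br x y) = 0 := by
  rw [← T_br, br_comm, br_sq_self, map_zero, LinearMap.zero_apply]

theorem br_self (x : J) : S.br x x = 0 := by
  refine S.ext_T fun z => ?_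
  simp only [br, cross_self, T_self, map_add, map_smul, LinearMap.add_apply,
    LinearMap.smul_apply, smul_eq_mul, map_zero, LinearMap.zero_apply]
  grind

theorem T_sq_self {x : J} (hx : S.T x S.c = 0) : S.T (S.sq x) x = S.N x := by
  simp only [sq, hx, map_add, map_smul, LinearMap.add_apply, LinearMap.smul_apply, smul_eq_mul,
    T_sharp_self, S.T_symm S.c]
  grind

theorem trace_sq (hk : ∀ t : k, t * t = t) (x : J) : S.T (S.sq x) S.c = S.T x S.c := by
  simp only [sq, map_add, map_smul, LinearMap.add_apply, LinearMap.smul_apply, smul_eq_mul,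
    T_base_base]
  grind

theorem trace_sharp_sq (hk : ∀ t : k, t * t = t) (x : J) :
    S.T (S.sharp (S.sq x)) S.c = S.T (S.sharp x) S.c := by
  simp only [sq, trace_sharp_add, sharp_smul, adjoint, sharp_c, map_add, map_smul,
    LinearMap.add_apply, LinearMap.smul_apply, smul_eq_mul, T_base_base, T_sharp_self]
  have := hk (S.T x S.c)
  have := hk (S.T (S.sharp x) S.c)
  grind

theorem trace_sharp_br (hk : ∀ t : k, t * t = t) (x y : J) :
    S.T (S.sharp (S.br x y)) S.c = S.T x y + S.T (S.sq x) (S.sq y) := by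
  have h := S.trace_sharp_sq hk (x + y)
  have h1 := S.T_sq_br x y
  have h2 := S.T_sq_br y x
  rw [S.br_comm y] at h2
  simp only [sq_add, trace_sharp_add, map_add, LinearMap.add_apply, S.trace_sharp_sq hk,
    S.trace_sq hk, trace_br, h1, h2] at h
  grind

theorem br_br (hk : ∀ t : k, t * t = t) (x y : J) : S.br x (S.br x y) = S.br (S.sq x) y := by
  refine S.ext_T fun z => ?_
  have h := S.trace_sharp_br hk x (y + z)
  simp only [br_add_right, sq_add, trace_sharp_add, map_add, S.trace_sharp_br hk, trace_br] at h
  have e1 := S.T_br x (S.br x y) z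
  have e2 := S.T_br y (S.sq x) z
  rw [S.br_comm y] at e2
  have e3 := S.T_symm (S.br x y) (S.br x z)
  grind

theorem sq_sq (hk : ∀ t : k, t * t = t) {x : J} (hx : S.T x S.c = 0) :
    S.sq (S.sq x) = S.T (S.sharp x) S.c • S.sq x + S.N x • x := by
  have h := hk (S.T (S.sharp x) S.c)
  have e : S.sq x = S.sharp x + S.T (S.sharp x) S.c • S.c := by
    rw [sq, hx, zero_smul, add_zero]
  rw [sq, S.trace_sq hk, S.trace_sharp_sq hk, hx, e]
  simp only [sharp_add, cross_smul_right, S.cross_comm _ S.c, cross_base, sharp_smul,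
    sharp_c, adjoint]
  refine S.ext_T fun z => ?_
  simp only [map_add, map_sub, map_smul, LinearMap.add_apply, LinearMap.sub_apply,
    LinearMap.smul_apply, smul_eq_mul]
  grind

theorem br_sq_eq_zero (hk : ∀ t : k, t * t = t)
    {v y : J} (hv : S.T v S.c = 0) (hy : S.T y S.c = 0)
    (hvy : S.br v y = 0) (h1 : S.T v y = 0) (h2 : S.T (S.sq v) y = 0) (hN : S.N v = 1) :
    S.br v (S.sq y) = 0 ∧ S.T v (S.sq y) = S.N y ∧
    S.T (S.sharp v) S.c • S.sq y + S.T (S.sharp y) S.c • S.sq v + (1 + S.N y) • y = 0 := by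
  have tvv := S.T_sq_self hv
  have tyy := S.T_sq_self hy
  have hvy0 : S.T (v + y) S.c = 0 := by simp [hv, hy]
  have tvy := S.T_sq_self hvy0
  have q := S.sq_sq hk hvy0
  rw [sq_add, hvy, add_zero] at q tvy
  rw [sq_add, S.sq_sq hk hv, S.sq_sq hk hy, trace_sharp_add, hv, hy, h1, hN, ← tvy,
    ← S.br_br hk] at q
  have b1 := S.br_br hk v (S.br v (S.br v (S.sq y)))
  have b2 := S.br_br hk (S.sq v) (S.sq y)
  have b3 := S.br_br hk v (S.sq y)
  rw [S.sq_sq hk hv, hN, one_smul, br_add_left, br_smul_left, ← b3] at b2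
  have bvs : S.br v (S.sq v) = 0 := by rw [br_comm, br_sq_self]
  have q1 := congrArg (S.br v) q
  simp only [br_add_right, br_smul_right, S.br_self, hvy, bvs, smul_zero, zero_add,
    add_zero] at q1
  have q2 : S.br v (S.br v (S.br v (S.sq y))) =
      S.T (S.sharp v) S.c • S.br v (S.sq y) := by
    linear_combination (norm := module) q1
  have hp : S.br v (S.sq y) = 0 := by
    rw [← b1, q2, br_smul_right] at b2
    simpa using b2
  have e0 : S.br v (0 : J) = 0 := by simpa using S.br_smul_right v 0 0
  have hq : S.T (S.sq v) (S.sq y) = 0 := by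
    have := S.trace_sharp_br hk v y
    rw [hvy, h1, sharp_zero, map_zero, LinearMap.zero_apply] at this
    simpa using this.symm
  have hφ : S.T v (S.sq y) = S.N y := by
    have q3 := congrArg (S.T (S.sq y)) q
    have e1 := S.T_self (S.sq y)
    rw [S.trace_sq hk, hy] at e1
    rw [hp, e0] at q3
    have e2 := S.T_symm (S.sq y) (S.sq v)
    have e3 := S.T_symm (S.sq y) v
    have e4 := hk (S.T v (S.sq y))
    have e5 := hk (S.N y)
    have e6 := S.T_symm (S.sq v) y
    simp only [map_add, map_smul, LinearMap.add_apply, smul_eq_mul] at q3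
    grind
  refine ⟨hp, hφ, S.ext_T fun z => ?_⟩
  rw [hp, e0] at q
  have q3 := congrArg (fun w => S.T w z) q
  have e3 := S.T_symm (S.sq y) v
  have e4 := S.T_symm (S.sq v) v
  simp only [map_add, map_smul, LinearMap.add_apply, LinearMap.smul_apply, smul_eq_mul,
    map_zero, LinearMap.zero_apply] at q3 ⊢
  grind

theorem eq_zero_of_br_eq_zero (hk : ∀ t : k, t * t = t)
    {v y : J} (hv : S.T v S.c = 0) (hy : S.T y S.c = 0)
    (hvy : S.br v y = 0) (h1 : S.T v y = 0) (h2 : S.T (S.sq v) y = 0) (hN : S.N v = 1) :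
    y = 0 := by
  obtain ⟨hp, hτ, h⟩ := S.br_sq_eq_zero hk hv hy hvy h1 h2 hN
  have h01 : ∀ t : k, t = 0 ∨ t = 1 := fun t => by
    have := hk t
    grind
  have tvv := S.T_sq_self hv
  have tyy := S.T_sq_self hy
  have qv := S.sq_sq hk hv
  have qy := S.sq_sq hk hy
  have hσ := congrArg (S.T v) h
  have s1 := S.T_symm (S.sq v) v
  simp only [map_add, map_smul, smul_eq_mul, h1, hτ, map_zero] at hσ
  rcases h01 (S.N y) with hn | hn <;> rcases h01 (S.T (S.sharp v) S.c) with hs | hs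
  · simpa [hn, hs, show S.T (S.sharp y) S.c = 0 by grind] using h
  · have hs' : S.T (S.sharp y) S.c = 0 := by grind
    rw [hn, hs, hs', one_smul, zero_smul, add_zero, add_zero, one_smul,
      add_eq_zero_iff_of_charTwo k] at h
    rw [hs', hn, zero_smul, zero_smul, add_zero, h, h] at qy
    exact qy
  · have hs' : S.T (S.sharp y) S.c = 0 := by grind
    rw [hs', hn, zero_smul, zero_add, one_smul] at qy
    rw [hs, hN, zero_smul, zero_add, one_smul] at qv
    have hsy : S.T (S.sq y) S.c = 0 := by rw [S.trace_sq hk, hy]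
    have hvy0 : S.T (v + S.sq y) S.c = 0 := by
      rw [map_add, LinearMap.add_apply, hv, hsy, add_zero]
    have q := S.sq_sq hk hvy0
    have n := S.T_sq_self hvy0
    have hb : S.br (S.sq v) y = 0 := by
      rw [← S.br_br hk, hvy]
      simpa using S.br_smul_right v 0 0
    rw [sq_add, hp, add_zero, qy] at q n
    rw [sq_add, hb, add_zero, qv, trace_sharp_add, hs, S.trace_sharp_sq hk, hs', hv, hτ, hn,
      ← n] at q
    have hq : S.T (S.sq v) (S.sq y) = 0 := by
      have := S.trace_sharp_br hk v y
      rw [hvy, h1, sharp_zero, map_zero, LinearMap.zero_apply] at this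
      simpa using this.symm
    have q1 := congrArg (S.T (S.sq v)) q
    have q2 := S.T_self (S.sq v)
    rw [S.trace_sq hk, hv] at q2
    have s2 := S.T_symm v y
    have s3 := S.T_symm (S.sq y) y
    simp only [map_add, map_smul, LinearMap.add_apply, smul_eq_mul] at q1
    grind
  · have hs' : S.T (S.sharp y) S.c = 1 := by grind
    have q1 := congrArg (S.T y) h
    have s2 := S.T_symm (S.sq v) y
    have s3 := S.T_symm (S.sq y) y
    have q2 := S.T_self y
    simp only [map_add, map_smul, smul_eq_mul, map_zero] at q1
    grind

theorem eq_zero_of_br_eq_self (hk : ∀ t : k, t * t = t)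
    {v y : J} (hv : S.T v S.c = 0) (hvy : S.br v y = y)
    (hN : S.N v = S.T (S.sharp v) S.c) : y = 0 := by
  have b1 := S.br_br hk v y
  have b2 := S.br_br hk (S.sq v) y
  rw [hvy, hvy] at b1
  rw [← b1, ← b1, S.sq_sq hk hv, br_add_left, br_smul_left, br_smul_left, ← b1, hvy, hN,
    (add_eq_zero_iff_of_charTwo k).2 rfl] at b2
  exact b2

theorem eq_zero_of_cross_eq_zero_of_idempotent (hk : ∀ t : k, t * t = t)
    {w y : J} (hwy : S.cross w y = 0)
    (h2 : S.T (S.sharp w) y = 0) (hN : S.N w ≠ 0) : y = 0 := by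
  have h01 : ∀ t : k, t = 0 ∨ t = 1 := fun t => by
    have := hk t
    grind
  have hN1 : S.N w = 1 := (h01 _).resolve_left hN
  have ht := S.T_cross_base w y
  rw [hwy, map_zero, LinearMap.zero_apply] at ht
  have hbr : S.br w y = S.T w S.c • y + S.T y S.c • w := by
    rw [br, hwy, show S.T w S.c * S.T y S.c + S.T w y = 0 by grind]
    module
  have i1 := hk (S.T w S.c)
  have i2 := hk (S.T y S.c)
  have hy : S.T y S.c = 0 := by
    have e := S.T_br w y (S.sq w)
    rw [S.br_comm w (S.sq w), br_sq_self, hbr, map_zero] at e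
    have s1 := S.T_sharp_self w
    have s2 := S.T_self w
    have s3 := S.T_symm w y
    simp only [sq, map_add, map_smul, LinearMap.add_apply, LinearMap.smul_apply, smul_eq_mul,
      S.T_symm _ (S.sharp w)] at e
    grind
  rcases h01 (S.T w S.c) with hw | hw
  · refine S.eq_zero_of_br_eq_zero hk hw hy ?_ ?_ ?_ hN1
    · simp [hbr, hw, hy]
    · grind
    · simp [sq, hw, h2, S.T_symm S.c, hy]
  · have hcw : S.br S.c y = 0 := by
      rw [br, cross_base, T_base_base, S.T_symm S.c]
      refine S.ext_T fun z => ?_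
      simp [hy]
      grind
    refine S.eq_zero_of_br_eq_self hk (v := w + S.c) ?_ ?_ ?_
    · simp only [map_add, LinearMap.add_apply, T_base_base]
      grind
    · rw [br_add_left, hcw, hbr, hw, hy, one_smul, zero_smul, add_zero, add_zero]
    · rw [N_add, trace_sharp_add, sharp_c, base, T_base_base, hN1, hw]
      grind

end CharTwo

section Inverse

variable {k J : Type*} [Field k] [AddCommGroup J] [Module k J] (S : CubicNorm k J)

theorem adjoint_perturb {w y : J} (hwy : S.cross w y = 0) (h2 : S.T (S.sharp w) y = 0)
    (t : k) : t ^ 2 • S.cross (S.sharp w) (S.sharp y) = (t * S.N w) • y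
      + (t ^ 2 * S.T w (S.sharp y)) • (w + t • y) + (t ^ 3 * S.N y) • w := by
  have h := S.adjoint (w + t • y)
  rw [S.expand, h2, sharp_add, cross_smul_right, hwy, smul_zero, add_zero, sharp_add,
    sharp_smul, sharp_smul, cross_smul_right, adjoint, adjoint] at h
  linear_combination (norm := module) h

theorem eq_zero_of_cross_eq_zero {w y : J} (hwy : S.cross w y = 0)
    (h2 : S.T (S.sharp w) y = 0) (hN : S.N w ≠ 0) : y = 0 := by
  have hP := S.adjoint_perturb hwy h2
  have h1 := hP 1
  by_cases two : (2 : k) = 0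
  · by_cases hk : ∀ t : k, t * t = t
    · have : CharP k 2 := CharTwo.of_one_ne_zero_of_two_eq_zero one_ne_zero two
      exact S.eq_zero_of_cross_eq_zero_of_idempotent hk hwy h2 hN
    · push Not at hk
      obtain ⟨t, ht⟩ := hk
      have key : ∀ s : k, s ≠ 0 → s ≠ 1 →
          S.N w • y = s • (S.T w (S.sharp y) • y + S.N y • w) := fun s h0 h1' => by
        have e : (s * (1 - s)) •
            (S.N w • y - s • (S.T w (S.sharp y) • y + S.N y • w)) = 0 := by
          linear_combination (norm := module) s ^ 2 • h1 - hP s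
        exact sub_eq_zero.1 ((smul_eq_zero.1 e).resolve_left
          (mul_ne_zero h0 (sub_ne_zero.2 h1'.symm)))
      have t0 : t ≠ 0 := by rintro rfl; simp at ht
      have t1 : t ≠ 1 := by rintro rfl; simp at ht
      have t2 : t * t ≠ 1 := fun h => t1 (by
        have : (t - 1) ^ 2 = 0 := by linear_combination h + (1 - t) * two
        exact sub_eq_zero.1 (pow_eq_zero_iff two_ne_zero |>.1 this))
      have e1 := key t t0 t1
      have e2 := key (t * t) (mul_ne_zero t0 t0) t2
      have e3 : (t - 1) • S.N w • y = 0 := by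
        linear_combination (norm := module) t • e1 - e2
      exact (smul_eq_zero.1 ((smul_eq_zero.1 e3).resolve_left
        (sub_ne_zero.2 t1))).resolve_left hN
  · have hτ : S.T w (S.sharp y) = 0 := by
      have e := S.T_cross w y y
      rw [hwy, cross_self, map_zero, LinearMap.zero_apply, map_smul, smul_eq_mul] at e
      exact (mul_eq_zero.1 e.symm).resolve_left two
    have hm := hP (-1)
    rw [hτ] at h1 hm
    have e : S.N w • y + S.N y • w = 0 := by
      have : (2 : k) • (S.N w • y + S.N y • w) = 0 := by
        linear_combination (norm := module) hm - h1
      exact (smul_eq_zero.1 this).resolve_left two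
    have e' := congrArg (S.cross w) e
    have z : S.cross w 0 = 0 := by simpa using S.cross_smul_right 0 w 0
    rw [cross_add_right, cross_smul_right, cross_smul_right, hwy, cross_self, z, smul_zero,
      zero_add, smul_smul] at e'
    have hw : S.sharp w ≠ 0 := fun h => by
      have a := S.adjoint w
      rw [h, sharp_zero] at a
      have w0 : w = 0 := (smul_eq_zero.1 a.symm).resolve_left hN
      rw [w0, N_zero] at hN
      exact hN rfl
    have hy : S.N y = 0 :=
      (mul_eq_zero.1 ((smul_eq_zero.1 e').resolve_right hw)).resolve_right two
    rw [hy, zero_smul, add_zero] at e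
    exact (smul_eq_zero.1 e).resolve_left hN

theorem eq_zero_of_U_eq_zero {x y : J} (hx : S.N x ≠ 0) (h : S.U x y = 0) : y = 0 := by
  rw [U, sub_eq_zero] at h
  have hT : S.T x y = 0 := by
    have e := congrArg (fun z => S.T z (S.sharp x)) h
    simp only [map_smul, LinearMap.smul_apply, smul_eq_mul] at e
    rw [cross_comm, T_cross, cross_self, adjoint, S.T_symm x (S.sharp x), T_sharp_self,
      map_smul, map_smul, smul_eq_mul, smul_eq_mul, S.T_symm y x] at e
    have e' : S.N x * S.T x y = 0 := by linear_combination e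
    exact (mul_eq_zero.1 e').resolve_left hx
  rw [hT, zero_smul] at h
  refine S.eq_zero_of_cross_eq_zero h.symm (by simp [adjoint, hT]) fun hN => ?_
  have e := S.adjoint (S.sharp x)
  rw [hN, zero_smul, S.adjoint x, sharp_smul] at e
  have hs := (smul_eq_zero.1 e).resolve_left (pow_ne_zero 2 hx)
  have a := S.adjoint x
  rw [hs, sharp_zero] at a
  have x0 := (smul_eq_zero.1 a.symm).resolve_left hx
  rw [x0, N_zero] at hx
  exact hx rfl

theorem U_bijective [FiniteDimensional k J] {x : J} (hx : S.N x ≠ 0) :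
    Function.Bijective (S.U x) := by
  let f : J →ₗ[k] J :=
    { toFun := S.U x
      map_add' := S.U_add x
      map_smul' := S.U_smul x }
  have hf : Function.Injective f :=
    (injective_iff_map_eq_zero f).2 fun _ h => S.eq_zero_of_U_eq_zero hx h
  exact ⟨hf, LinearMap.injective_iff_surjective.1 hf⟩

end Inverse

end CubicNorm

/-- In a cubic Jordan algebra `J(N,c)`, an element `x` is invertible
(i.e. its `U`-operator `U_x` is invertible) if and only if `N x ≠ 0`, and in that
case `x⁻¹ = N(x)⁻¹ • x^#` (i.e. `U_x` carries `N(x)⁻¹ • x^#` to `x`). -/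
theorem stmt2 {k J : Type*} [Field k] [AddCommGroup J] [Module k J]
    [FiniteDimensional k J] (S : CubicNorm k J) (x : J) :
    (Function.Bijective (S.U x) ↔ S.N x ≠ 0) ∧
      (S.N x ≠ 0 → S.U x ((S.N x)⁻¹ • S.sharp x) = x) := by
  refine ⟨⟨S.N_ne_zero_of_U_bijective x, S.U_bijective⟩, fun h => ?_⟩
  rw [S.U_smul, S.U_sharp, smul_smul, inv_mul_cancel₀ h, one_smul]
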